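/- Define for each d ≥ 1 and 1 ≤ t ≤ d+1 the R-linear map α_{d-t+1} : C_{d-t+1}(x, 1^d) → C_{d-t+1}(-x-2d, 1^d) on basis elements by α(f_{(λ_t,…,λ_1)}) = ∑_{μ_1+⋯+μ_t = d-t+1} (-1)^{d - μ_t} ∏_{s=0}^{t-2} binom(∑_{j=1}^{s}(λ_j+μ_j)+μ_{s+1}+2s, ∑_{j=1}^{s}(λ_j+μ_j)+λ_{s+1}+2s) · f_{(μ_t,…,μ_1)}. Then α_• is a chain map: α_{d-t} ∘ ∂^x_{d-t+1} = ∂^{-x-2d}_{d-t+1} ∘ α_{d-t+1} for all 1 ≤ t ≤ d. -/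

import Mathlib

open Finset

/-- Generalized binomial coefficient `binom(a, b)` for integers `a, b`:
`a(a-1)⋯(a-b+1)/b!` when `b ≥ 0`, and `0` when `b < 0`. -/
noncomputable def zbinom (a b : ℤ) : ℤ := if 0 ≤ b then Ring.choose a b.toNat else 0

/-- `S(s) = ∑_{m=1}^{s} (μ_m + λ_m)`. -/
def Sfun (lam mu : ℕ → ℕ) (s : ℕ) : ℤ := ∑ m ∈ Finset.Icc 1 s, ((mu m : ℤ) + (lam m : ℤ))

/-- `A_k(λ,μ) = ∏_{s=0}^{k-2} binom(S(s)+μ_{s+1}+2s, S(s)+λ_{s+1}+2s)`. -/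
noncomputable def Afun (lam mu : ℕ → ℕ) (k : ℕ) : ℤ :=
  ∏ s ∈ Finset.range (k - 1),
    zbinom (Sfun lam mu s + (mu (s+1) : ℤ) + 2 * s) (Sfun lam mu s + (lam (s+1) : ℤ) + 2 * s)

/-- `B_k(λ,μ) = ∏_{s=k+1}^{t-1} binom(S(s-1)+μ_s+μ_{s+1}+2s-1, S(s)+2s-1)`. -/
noncomputable def Bfun (t : ℕ) (lam mu : ℕ → ℕ) (k : ℕ) : ℤ :=
  ∏ s ∈ Finset.Icc (k + 1) (t - 1),
    zbinom (Sfun lam mu (s - 1) + (mu s : ℤ) + (mu (s+1) : ℤ) + 2 * s - 1)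
      (Sfun lam mu s + 2 * s - 1)

/-- `g_k(λ,μ;z) = binom(S(k-1)+μ_k+2(k-1), S(k-1)+λ_k-z+2(k-1))`. -/
noncomputable def gfun (lam mu : ℕ → ℕ) (k : ℕ) (z : ℤ) : ℤ :=
  zbinom (Sfun lam mu (k - 1) + (mu k : ℤ) + 2 * ((k : ℤ) - 1))
    (Sfun lam mu (k - 1) + (lam k : ℤ) - z + 2 * ((k : ℤ) - 1))

/-- `h_k(λ,μ;z) = binom(S(k)+μ_{k+1}-z+2(k-1)+2, S(k)+2(k-1)+1)`. -/
noncomputable def hfun (lam mu : ℕ → ℕ) (k : ℕ) (z : ℤ) : ℤ :=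
  zbinom (Sfun lam mu k + (mu (k+1) : ℤ) - z + 2 * ((k : ℤ) - 1) + 2)
    (Sfun lam mu k + 2 * ((k : ℤ) - 1) + 1)

/-- Reindexing of a tuple `f : Fin n → ℕ` (with `f ⟨m-1⟩` giving the part with subscript
`m`) as a function `ℕ → ℕ` supported on `{1, …, n}`. -/
def toFun (n : ℕ) (f : Fin n → ℕ) : ℕ → ℕ :=
  fun m => if h : 1 ≤ m ∧ m ≤ n then f ⟨m - 1, by omega⟩ else 0

/-- The weak composition `(λ_t, …, λ_{j+1}, i-1, λ_j - i, λ_{j-1}, …, λ_1)` (with `t+1`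
parts, subscripts `1, …, t+1`) obtained from `λ = (λ_t, …, λ_1)` by splitting the `j`-th
interval at its `i`-th edge. -/
def split (lam : ℕ → ℕ) (j i : ℕ) : ℕ → ℕ := fun m =>
  if m < j then lam m else if m = j then lam j - i else if m = j + 1 then i - 1 else lam (m - 1)

/-- The coefficient of `f_ν` in `∂(f_λ)`, for the arithmetic complex `C_•(w_0, 1^d)` with
`w_0 = x`: the differential is
`∂(f_{(λ_t,…,λ_1)}) = ∑_{j=1}^{t} ∑_{i=1}^{λ_j} (-1)^{t-j} binom(ω(I_{λ_j}), ω(I_{λ_j}∖{i}))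
f_{(λ_t,…,λ_{j+1},i-1,λ_j-i,λ_{j-1},…,λ_1)}`,
where `λ` has `t` parts, `ω(I_{λ_j}) = λ_j + 1` for `j < t` and `x + λ_t` for `j = t`
(the leftmost interval contains the vertex of weight `w_0 = x`), and
`ω(I_{λ_j}∖{i}) = λ_j - i + 1`. -/
noncomputable def Dmat (x : ℤ) (t : ℕ) (nu lam : ℕ → ℕ) : ℤ :=
  ∑ j ∈ Finset.Icc 1 t, ∑ i ∈ Finset.Icc 1 (lam j),
    if ∀ m ∈ Finset.Icc 1 (t + 1), nu m = split lam j i m then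
      (-1 : ℤ) ^ (t - j) *
        (if j = t then zbinom (x + (lam t : ℤ)) ((lam t : ℤ) - i + 1)
          else zbinom ((lam j : ℤ) + 1) ((lam j : ℤ) - i + 1))
    else 0

/-- The coefficient of `f_μ` in `α(f_λ)`, for weak compositions `λ, μ` with `t` parts:
`(-1)^{d-μ_t} ∏_{s=0}^{t-2} binom(∑_{j≤s}(λ_j+μ_j)+μ_{s+1}+2s, ∑_{j≤s}(λ_j+μ_j)+λ_{s+1}+2s)`. -/
noncomputable def Amat (d t : ℕ) (lam mu : ℕ → ℕ) : ℤ :=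
  (-1 : ℤ) ^ (d - mu t) * Afun lam mu t

theorem zbinom_natCast (a b : ℕ) : zbinom a b = (a.choose b : ℤ) := by
  simp [zbinom, Ring.choose_natCast]

theorem zbinom_eq_choose {x y : ℤ} (a b : ℕ) (hx : x = a) (hy : y = b) :
    zbinom x y = (a.choose b : ℤ) := by
  rw [hx, hy, zbinom_natCast]

/-- Saalschütz's identity for binomial coefficients. -/
theorem sum_choose_mul_choose_mul_choose (M N m n r s : ℕ) (h : M + N = m + n)
    (hs : s + m = M + r) :
    ∑ k ∈ range (n + 1), M.choose k * N.choose (n - k) * (r + k).choose (m + n) =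
      r.choose m * s.choose n := by
  have expand : ∀ k ∈ range (n + 1), (r + k).choose (m + n) =
      ∑ j ∈ range (n + 1), k.choose j * r.choose (m + n - j) := by
    intro k hk
    rw [mem_range] at hk
    rw [add_comm r k, Nat.add_choose_eq, Finset.Nat.sum_antidiagonal_eq_sum_range_succ
      (fun i j => k.choose i * r.choose j)]
    symm
    apply Finset.sum_subset
    · intro j hj
      simp only [mem_range] at *
      omega
    · intro j _ hj
      simp only [mem_range, not_lt] at hj
      rw [Nat.choose_eq_zero_of_lt (by omega), zero_mul]
  have inner : ∀ j ∈ range (n + 1),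
      ∑ k ∈ range (n + 1), M.choose k * N.choose (n - k) * k.choose j =
        M.choose j * (m + n - j).choose (n - j) := by
    intro j hj
    rw [mem_range] at hj
    rcases Nat.lt_or_ge M j with hM | hM
    · rw [Nat.choose_eq_zero_of_lt hM, zero_mul]
      apply Finset.sum_eq_zero
      intro k _
      rcases Nat.lt_or_ge M k with h1 | h1
      · rw [Nat.choose_eq_zero_of_lt h1]; simp
      · rw [Nat.choose_eq_zero_of_lt (show k < j by omega)]; simp
    have hn : n + 1 = j + (n - j + 1) := by omega
    rw [hn, Finset.sum_range_add]
    rw [Finset.sum_eq_zero (fun k hk => by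
      rw [Nat.choose_eq_zero_of_lt (mem_range.mp hk), mul_zero]), zero_add]
    rw [show m + n - j = (M - j) + N by omega, Nat.add_choose_eq,
      Finset.Nat.sum_antidiagonal_eq_sum_range_succ
      (fun i l => (M - j).choose i * N.choose l), Finset.mul_sum]
    apply Finset.sum_congr rfl
    intro k hk
    rw [mem_range] at hk
    rw [show n - (j + k) = n - j - k by omega]
    have := Nat.choose_mul (n := M) (Nat.le_add_right j k)
    rw [Nat.add_sub_cancel_left] at this
    calc _ = M.choose (j + k) * (j + k).choose j * N.choose (n - j - k) := by ring
      _ = _ := by rw [this]; ring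
  have outer : ∀ j ∈ range (n + 1),
      r.choose (m + n - j) * (m + n - j).choose (n - j) =
        r.choose m * (r - m).choose (n - j) := by
    intro j hj
    rw [mem_range] at hj
    rw [← Nat.choose_symm (show n - j ≤ m + n - j by omega),
      show m + n - j - (n - j) = m by omega]
    rw [Nat.choose_mul (by omega), show m + n - j - m = n - j by omega]
  calc _ = ∑ k ∈ range (n + 1), ∑ j ∈ range (n + 1),
        (M.choose k * N.choose (n - k) * k.choose j) * r.choose (m + n - j) := by
        apply Finset.sum_congr rfl
        intro k hk
        rw [expand k hk, Finset.mul_sum]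
        exact Finset.sum_congr rfl fun j _ => by ring
    _ = ∑ j ∈ range (n + 1), M.choose j * (r.choose m * (r - m).choose (n - j)) := by
        rw [Finset.sum_comm]
        apply Finset.sum_congr rfl
        intro j hj
        rw [← Finset.sum_mul, inner j hj, ← outer j hj]
        ring
    _ = r.choose m * s.choose n := by
        rcases Nat.lt_or_ge r m with h2 | h2
        · rw [Nat.choose_eq_zero_of_lt h2]; simp
        · rw [show s = M + (r - m) by omega, Nat.add_choose_eq,
            Finset.Nat.sum_antidiagonal_eq_sum_range_succ
            (fun i l => M.choose i * (r - m).choose l), Finset.mul_sum]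
          exact Finset.sum_congr rfl fun j _ => by ring

theorem zbinom_add_sub_one (a p k : ℕ) :
    zbinom (a + p) (a + k - 1) = if k ≤ p + 1 then ((a + p).choose (p + 1 - k) : ℤ) else 0 := by
  split_ifs with hk
  · rcases Nat.eq_zero_or_pos (a + k) with h0 | h0
    · have ha : a = 0 := by omega
      have hk : k = 0 := by omega
      subst ha hk
      rw [zbinom, if_neg (by norm_num), Nat.choose_eq_zero_of_lt (by omega)]
      simp
    · rw [zbinom_eq_choose (a + p) (a + k - 1) (by push_cast; ring) (by omega),
        ← Nat.choose_symm (show a + k - 1 ≤ a + p by omega)]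
      congr 2
      omega
  · rw [zbinom_eq_choose (a + p) (a + k - 1) (by push_cast; ring) (by omega),
      Nat.choose_eq_zero_of_lt (by omega)]
    simp

theorem sum_choose_mul_zbinom_mul_zbinom (a p q l : ℕ) :
    ∑ i ∈ range (l + 2), ((l + 1).choose i : ℤ) * zbinom (a + p) (a + l - i) *
        zbinom (a + l + p + q + 2 - i) (a + l + p + 1) =
      ((p + q + 2).choose (p + 1) : ℤ) * ((a + p + q + 1).choose (a + l) : ℤ) := by
  have key := sum_choose_mul_choose_mul_choose (l + 1) (a + p) (a + l) (p + 1)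
    (a + p + q + 1) (p + q + 2) (by ring) (by ring)
  have key' : (∑ k ∈ range (p + 2), ((l + 1).choose k : ℤ) * zbinom (a + p) (a + k - 1) *
      ((a + p + q + 1 + k).choose (a + l + (p + 1)) : ℤ)) =
      ((p + q + 2).choose (p + 1) : ℤ) * ((a + p + q + 1).choose (a + l) : ℤ) := by
    rw [mul_comm ((p + q + 2).choose (p + 1) : ℤ), ← Nat.cast_mul, ← key, Nat.cast_sum]
    apply Finset.sum_congr rfl
    intro k hk
    rw [mem_range] at hk
    rw [zbinom_add_sub_one, if_pos (by omega)]
    push_cast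
    rfl
  rw [← key', ← Finset.sum_range_reflect]
  trans ∑ k ∈ range (l + 2), ((l + 1).choose k : ℤ) * zbinom (a + p) (a + k - 1) *
      ((a + p + q + 1 + k).choose (a + l + (p + 1)) : ℤ)
  · apply Finset.sum_congr rfl
    intro k hk
    rw [mem_range] at hk
    rw [show l + 2 - 1 - k = l + 1 - k by omega, Nat.choose_symm (by omega)]
    congr 1
    · congr 2
      omega
    · exact zbinom_eq_choose _ _ (by push_cast [show k ≤ l + 1 by omega]; ring)
        (by push_cast; ring)
  · trans ∑ k ∈ range (l + p + 2), ((l + 1).choose k : ℤ) * zbinom (a + p) (a + k - 1) *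
      ((a + p + q + 1 + k).choose (a + l + (p + 1)) : ℤ)
    · apply Finset.sum_subset
      · intro k; simp only [mem_range]; omega
      · intro k _ hk
        simp only [mem_range, not_lt] at hk
        rw [Nat.choose_eq_zero_of_lt (show l + 1 < k by omega)]
        simp
    · symm
      apply Finset.sum_subset
      · intro k; simp only [mem_range]; omega
      · intro k _ hk
        simp only [mem_range, not_lt] at hk
        rw [zbinom_add_sub_one, if_neg (by omega)]
        simp

theorem Sfun_zero (lam mu : ℕ → ℕ) : Sfun lam mu 0 = 0 := by simp [Sfun]

theorem Sfun_succ (lam mu : ℕ → ℕ) (s : ℕ) :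
    Sfun lam mu (s + 1) = Sfun lam mu s + mu (s + 1) + lam (s + 1) := by
  rw [Sfun, Finset.sum_Icc_succ_top (by omega), Sfun]
  ring

theorem exists_Sfun_eq_natCast (lam mu : ℕ → ℕ) (s : ℕ) : ∃ a : ℕ, Sfun lam mu s = a :=
  ⟨∑ m ∈ Finset.Icc 1 s, (mu m + lam m), by simp [Sfun]⟩

theorem Sfun_congr {lam lam' mu mu' : ℕ → ℕ} {s : ℕ} (hl : ∀ m, 1 ≤ m → m ≤ s → lam m = lam' m)
    (hm : ∀ m, 1 ≤ m → m ≤ s → mu m = mu' m) : Sfun lam mu s = Sfun lam' mu' s := by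
  apply Finset.sum_congr rfl
  intro m h
  rw [Finset.mem_Icc] at h
  rw [hl m h.1 h.2, hm m h.1 h.2]

theorem Afun_congr {lam lam' mu mu' : ℕ → ℕ} {k : ℕ} (hl : ∀ m, 1 ≤ m → m < k → lam m = lam' m)
    (hm : ∀ m, 1 ≤ m → m < k → mu m = mu' m) : Afun lam mu k = Afun lam' mu' k := by
  apply Finset.prod_congr rfl
  intro s h
  rw [mem_range] at h
  rw [Sfun_congr (fun m h1 h2 => hl m h1 (by omega)) (fun m h1 h2 => hm m h1 (by omega)),
    hl (s + 1) (by omega) (by omega), hm (s + 1) (by omega) (by omega)]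

theorem Afun_succ (lam mu : ℕ → ℕ) (k : ℕ) :
    Afun lam mu (k + 2) = Afun lam mu (k + 1) *
      zbinom (Sfun lam mu k + mu (k + 1) + 2 * k) (Sfun lam mu k + lam (k + 1) + 2 * k) := by
  simp only [Afun, Nat.add_sub_cancel, show k + 2 - 1 = k + 1 by omega, Finset.prod_range_succ]

/-- The weak composition obtained from `nu` by merging the `j`-th and `(j+1)`-st intervals. -/
def merge (nu : ℕ → ℕ) (j : ℕ) : ℕ → ℕ := fun m =>
  if m < j then nu m else if m = j then nu j + nu (j + 1) + 1 else nu (m + 1)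

theorem Sfun_split {lam nu : ℕ → ℕ} {j i : ℕ} (hi : 1 ≤ i) (hij : i ≤ lam (j + 1)) (s : ℕ) :
    Sfun (split lam (j + 1) i) nu (j + 2 + s) =
      Sfun lam nu (j + 1 + s) + nu (j + 2 + s) - 1 := by
  induction s with
  | zero =>
    simp only [add_zero, Sfun_succ]
    rw [Sfun_congr (lam := split lam (j + 1) i) (lam' := lam) (mu' := nu) _ (fun _ _ _ => rfl)]
    · simp only [split, lt_irrefl, if_true, if_false, show ¬ (j + 1 + 1 < j + 1) by omega,
        show ¬ (j + 1 + 1 = j + 1) by omega]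
      push_cast [hij, hi]
      ring
    · intro m h1 h2
      simp only [split, if_pos (show m < j + 1 by omega)]
  | succ s ih =>
    rw [← add_assoc, Sfun_succ, ih, ← add_assoc, Sfun_succ]
    simp only [split]
    rw [if_neg (by omega), if_neg (by omega), if_neg (by omega)]
    rw [show j + 2 + s = j + 1 + s + 1 by ring, Nat.add_sub_cancel]
    ring

theorem Sfun_merge (lam nu : ℕ → ℕ) (j s : ℕ) :
    Sfun lam (merge nu (j + 1)) (j + 1 + s) =
      Sfun lam nu (j + 1 + s) + nu (j + 2 + s) + 1 := by
  induction s with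
  | zero =>
    simp only [add_zero, Sfun_succ]
    rw [Sfun_congr (lam' := lam) (mu' := nu) (fun _ _ _ => rfl)]
    · simp [merge]
      ring
    · intro m h1 h2
      simp only [merge, if_pos (show m < j + 1 by omega)]
  | succ s ih =>
    rw [← add_assoc, Sfun_succ, ih, Sfun_succ]
    simp only [merge]
    rw [if_neg (by omega), if_neg (by omega)]
    rw [show j + 2 + s = j + 1 + s + 1 by ring, show j + 2 + (s + 1) = j + 1 + s + 1 + 1 by ring]
    ring

theorem Afun_split_lt {lam nu : ℕ → ℕ} {j n i : ℕ} (hj : j < n) (hi : 1 ≤ i)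
    (hij : i ≤ lam (j + 1)) :
    Afun (split lam (j + 1) i) nu (n + 2) = Afun lam nu (j + 1) * gfun lam nu (j + 1) i *
      hfun lam nu (j + 1) i * Bfun (n + 1) lam nu (j + 1) := by
  obtain ⟨k, rfl⟩ := Nat.exists_eq_add_of_le hj
  have hS : Sfun (split lam (j + 1) i) nu j = Sfun lam nu j := by
    refine Sfun_congr (fun m h1 h2 => ?_) (fun _ _ _ => rfl)
    simp only [split, if_pos (show m < j + 1 by omega)]
  have hA : Afun (split lam (j + 1) i) nu (j + 1) = Afun lam nu (j + 1) := by
    refine Afun_congr (fun m h1 h2 => ?_) (fun _ _ _ => rfl)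
    simp only [split, if_pos h2]
  have step : Afun (split lam (j + 1) i) nu (j + 3) =
      Afun lam nu (j + 1) * gfun lam nu (j + 1) i * hfun lam nu (j + 1) i := by
    rw [Afun_succ, Afun_succ, Sfun_succ, hS, hA, gfun, hfun, Sfun_succ, Nat.add_sub_cancel]
    simp only [split, lt_irrefl, if_true, if_false, show ¬ (j + 1 + 1 < j + 1) by omega,
      show ¬ (j + 1 + 1 = j + 1) by omega]
    congr 2
    · congr 1 <;> push_cast [hij] <;> ring
    · push_cast [hij]; ring
    · push_cast [hij, hi]; ring
  have tail : ∏ s ∈ range k, zbinom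
      (Sfun (split lam (j + 1) i) nu (j + 2 + s) + (nu (j + 2 + s + 1) : ℤ)
        + 2 * ((j + 2 + s : ℕ) : ℤ))
      (Sfun (split lam (j + 1) i) nu (j + 2 + s) + (split lam (j + 1) i (j + 2 + s + 1) : ℤ)
        + 2 * ((j + 2 + s : ℕ) : ℤ)) = Bfun (j + 1 + k + 1) lam nu (j + 1) := by
    rw [Bfun, ← Finset.Ico_add_one_right_eq_Icc, Finset.prod_Ico_eq_prod_range]
    apply Finset.prod_congr
    · congr 1; omega
    · intro s _
      rw [Sfun_split hi hij, show j + 1 + 1 + s - 1 = j + 1 + s by omega,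
        show j + 1 + 1 + s = j + 1 + s + 1 by ring, Sfun_succ]
      simp only [split]
      rw [if_neg (by omega), if_neg (by omega), if_neg (by omega), Nat.add_sub_cancel]
      congr 1 <;> ring
  rw [← step, ← tail, Afun, Afun, show j.succ + k + 2 - 1 = (j + 2) + k by omega,
    Finset.prod_range_add]
  rfl

theorem Afun_split_last {lam nu : ℕ → ℕ} {n i : ℕ} (hij : i ≤ lam (n + 1)) :
    Afun (split lam (n + 1) i) nu (n + 2) = Afun lam nu (n + 1) * gfun lam nu (n + 1) i := by
  have hS : Sfun (split lam (n + 1) i) nu n = Sfun lam nu n := by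
    refine Sfun_congr (fun m h1 h2 => ?_) (fun _ _ _ => rfl)
    simp only [split, if_pos (show m < n + 1 by omega)]
  have hA : Afun (split lam (n + 1) i) nu (n + 1) = Afun lam nu (n + 1) := by
    refine Afun_congr (fun m h1 h2 => ?_) (fun _ _ _ => rfl)
    simp only [split, if_pos h2]
  rw [Afun_succ, hS, hA, gfun, Nat.add_sub_cancel]
  simp only [split, lt_irrefl, if_true, if_false]
  congr 2 <;> push_cast [hij] <;> ring

theorem Afun_merge_lt {lam nu : ℕ → ℕ} {j n : ℕ} (hj : j < n) :
    Afun lam (merge nu (j + 1)) (n + 1) = Afun lam nu (j + 1) *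
      zbinom (Sfun lam nu j + nu (j + 1) + nu (j + 2) + 2 * j + 1)
        (Sfun lam nu j + lam (j + 1) + 2 * j) * Bfun (n + 1) lam nu (j + 1) := by
  obtain ⟨k, rfl⟩ := Nat.exists_eq_add_of_le hj
  have hS : Sfun lam (merge nu (j + 1)) j = Sfun lam nu j := by
    refine Sfun_congr (fun _ _ _ => rfl) (fun m h1 h2 => ?_)
    simp only [merge, if_pos (show m < j + 1 by omega)]
  have hA : Afun lam (merge nu (j + 1)) (j + 1) = Afun lam nu (j + 1) := by
    refine Afun_congr (fun _ _ _ => rfl) (fun m h1 h2 => ?_)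
    simp only [merge, if_pos h2]
  have step : Afun lam (merge nu (j + 1)) (j + 2) = Afun lam nu (j + 1) *
      zbinom (Sfun lam nu j + nu (j + 1) + nu (j + 2) + 2 * j + 1)
        (Sfun lam nu j + lam (j + 1) + 2 * j) := by
    rw [Afun_succ, hS, hA]
    simp only [merge, lt_irrefl, if_true, if_false]
    congr 2
    push_cast
    ring
  have tail : ∏ s ∈ range k, zbinom
      (Sfun lam (merge nu (j + 1)) (j + 1 + s) + (merge nu (j + 1) (j + 1 + s + 1) : ℤ)
        + 2 * ((j + 1 + s : ℕ) : ℤ))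
      (Sfun lam (merge nu (j + 1)) (j + 1 + s) + (lam (j + 1 + s + 1) : ℤ)
        + 2 * ((j + 1 + s : ℕ) : ℤ)) = Bfun (j + 1 + k + 1) lam nu (j + 1) := by
    rw [Bfun, ← Finset.Ico_add_one_right_eq_Icc, Finset.prod_Ico_eq_prod_range]
    apply Finset.prod_congr
    · congr 1; omega
    · intro s _
      rw [Sfun_merge, show j + 1 + 1 + s - 1 = j + 1 + s by omega,
        show j + 1 + 1 + s = j + 1 + s + 1 by ring, Sfun_succ]
      simp only [merge]
      rw [if_neg (by omega), if_neg (by omega)]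
      congr 1 <;> push_cast <;> ring
  rw [← step, ← tail, Afun, Afun, show j.succ + k + 1 - 1 = (j + 1) + k by omega,
    Finset.prod_range_add]
  rfl

theorem Afun_merge_last (lam nu : ℕ → ℕ) (n : ℕ) :
    Afun lam (merge nu (n + 1)) (n + 1) = Afun lam nu (n + 1) := by
  refine Afun_congr (fun _ _ _ => rfl) (fun m h1 h2 => ?_)
  simp only [merge, if_pos h2]

theorem sum_Icc_gfun_mul_hfun (lam nu : ℕ → ℕ) (j : ℕ) :
    ∑ i ∈ Finset.Icc 1 (lam (j + 1)), ((lam (j + 1) + 1).choose i : ℤ) *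
        gfun lam nu (j + 1) i * hfun lam nu (j + 1) i =
      ((nu (j + 1) + nu (j + 2) + 2).choose (nu (j + 1) + 1) : ℤ) *
        zbinom (Sfun lam nu j + nu (j + 1) + nu (j + 2) + 2 * j + 1)
          (Sfun lam nu j + lam (j + 1) + 2 * j)
      - gfun lam nu (j + 1) 0 * hfun lam nu (j + 1) 0
      - gfun lam nu (j + 1) (lam (j + 1) + 1) * hfun lam nu (j + 1) (lam (j + 1) + 1) := by
  obtain ⟨a, ha⟩ := exists_Sfun_eq_natCast lam nu j
  have key := sum_choose_mul_zbinom_mul_zbinom (a + 2 * j) (nu (j + 1)) (nu (j + 2)) (lam (j + 1))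
  have hM : zbinom (Sfun lam nu j + nu (j + 1) + nu (j + 2) + 2 * j + 1)
      (Sfun lam nu j + lam (j + 1) + 2 * j) =
      ((a + 2 * j + nu (j + 1) + nu (j + 2) + 1).choose (a + 2 * j + lam (j + 1)) : ℤ) :=
    zbinom_eq_choose _ _ (by rw [ha]; push_cast; ring) (by rw [ha]; push_cast; ring)
  have hg : ∀ z : ℤ, gfun lam nu (j + 1) z =
      zbinom (((a + 2 * j : ℕ) : ℤ) + nu (j + 1)) (((a + 2 * j : ℕ) : ℤ) + lam (j + 1) - z) := by
    intro z
    rw [gfun, Nat.add_sub_cancel, ha]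
    congr 1 <;> (push_cast; ring)
  have hh : ∀ z : ℤ, hfun lam nu (j + 1) z =
      zbinom (((a + 2 * j : ℕ) : ℤ) + lam (j + 1) + nu (j + 1) + nu (j + 2) + 2 - z)
        (((a + 2 * j : ℕ) : ℤ) + lam (j + 1) + nu (j + 1) + 1) := by
    intro z
    rw [hfun, Sfun_succ, ha]
    congr 1 <;> (push_cast; ring)
  simp only [← hg, ← hh] at key
  rw [Finset.sum_range_succ, Finset.range_eq_Ico, Finset.sum_eq_sum_Ico_succ_bot (by omega),
    Finset.Ico_add_one_right_eq_Icc] at key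
  rw [hM, ← key]
  simp only [zero_add, Nat.choose_self, Nat.choose_zero_right]
  push_cast
  ring

/-- The telescoping sum of the contributions of all but the leftmost interval. -/
theorem sum_range_Afun_mul_Bfun (lam nu : ℕ → ℕ) (n m : ℕ) (hm : m ≤ n) :
    ∑ j ∈ range m, (-1 : ℤ) ^ j * (Afun lam nu (j + 1) * Bfun (n + 1) lam nu (j + 1) *
      (∑ i ∈ Finset.Icc 1 (lam (j + 1)), ((lam (j + 1) + 1).choose i : ℤ) *
          gfun lam nu (j + 1) i * hfun lam nu (j + 1) i -
        ((nu (j + 1) + nu (j + 2) + 2).choose (nu (j + 1) + 1) : ℤ) *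
          zbinom (Sfun lam nu j + nu (j + 1) + nu (j + 2) + 2 * j + 1)
            (Sfun lam nu j + lam (j + 1) + 2 * j))) =
    (-1) ^ m * (Afun lam nu (m + 1) * gfun lam nu (m + 1) (lam (m + 1) + 1) *
      Bfun (n + 1) lam nu m) := by
  induction m with
  | zero =>
    rw [gfun, zbinom, if_neg]
    · simp
    · simp [Sfun_zero]
  | succ m ih =>
    have hA : Afun lam nu (m + 2) = Afun lam nu (m + 1) * gfun lam nu (m + 1) 0 := by
      rw [Afun_succ, gfun, Nat.add_sub_cancel]
      congr 2 <;> (push_cast; ring)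
    have hB : Bfun (n + 1) lam nu m =
        hfun lam nu (m + 1) (lam (m + 1) + 1) * Bfun (n + 1) lam nu (m + 1) := by
      rw [Bfun, Nat.add_sub_cancel, ← Finset.mul_prod_Ioc_eq_prod_Icc hm,
        ← Finset.Icc_add_one_left_eq_Ioc, Bfun, hfun, Nat.add_sub_cancel, Nat.add_sub_cancel,
        Sfun_succ]
      congr 2 <;> (push_cast; ring)
    have hg : gfun lam nu (m + 2) (lam (m + 2) + 1) = hfun lam nu (m + 1) 0 := by
      rw [gfun, hfun, show m + 2 - 1 = m + 1 by omega]
      congr 1 <;> (push_cast; ring)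
    rw [Finset.sum_range_succ, ih (by omega), sum_Icc_gfun_mul_hfun, hg, hA, hB]
    ring

theorem sum_Icc_zbinom_mul_zbinom (x : ℤ) (a p l : ℕ) (h : p < l) :
    ∑ i ∈ Finset.Icc 1 (l + 1), zbinom (x + l) (l - i + 1) * zbinom (a + p) (a + l - i) =
      Ring.choose (x + l + (a + p)) (p + 1) := by
  rw [Ring.add_choose_eq _ (Commute.all _ _), Finset.Nat.sum_antidiagonal_eq_sum_range_succ
    (fun i k => Ring.choose (x + l) i * Ring.choose ((a : ℤ) + p) k)]
  trans ∑ k ∈ range (l + 1), zbinom (x + l) k * zbinom (a + p) (a + k - 1)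
  · rw [← Finset.sum_range_reflect, ← Finset.Ico_add_one_right_eq_Icc,
      Finset.sum_Ico_eq_sum_range]
    apply Finset.sum_congr rfl
    intro k hk
    rw [mem_range] at hk
    congr 2 <;> omega
  · symm
    apply Finset.sum_subset_zero_on_sdiff
    · intro k; simp only [mem_range]; omega
    · intro k hk
      simp only [mem_sdiff, mem_range] at hk
      rw [zbinom_add_sub_one, if_neg (by omega), mul_zero]
    · intro k hk
      rw [mem_range] at hk
      rw [zbinom_add_sub_one, if_pos (by omega), ← Nat.cast_add, Ring.choose_natCast]
      simp [zbinom]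

theorem le_of_Afun_ne_zero {lam nu : ℕ → ℕ} {k m : ℕ} (h : Afun lam nu (k + 1) ≠ 0) (h1 : 1 ≤ m)
    (hm : m ≤ k) : lam m ≤ nu m := by
  obtain ⟨s, rfl⟩ := Nat.exists_eq_add_of_le' h1
  rw [Afun, Finset.prod_ne_zero_iff] at h
  have := h s (by rw [mem_range]; omega)
  obtain ⟨a, ha⟩ := exists_Sfun_eq_natCast lam nu s
  rw [zbinom_eq_choose (a + nu (s + 1) + 2 * s) (a + lam (s + 1) + 2 * s)
    (by rw [ha]; push_cast; ring) (by rw [ha]; push_cast; ring)] at this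
  by_contra hlt
  exact this (by rw [Nat.choose_eq_zero_of_lt (by omega)]; rfl)

theorem Afun_mul_sum_Icc_zbinom_mul_gfun (x : ℤ) (lam nu : ℕ → ℕ) (n : ℕ)
    (h : ∑ m ∈ Finset.Icc 1 (n + 1), nu m < ∑ m ∈ Finset.Icc 1 (n + 1), lam m) :
    Afun lam nu (n + 1) * ∑ i ∈ Finset.Icc 1 (lam (n + 1)),
        zbinom (x + lam (n + 1)) (lam (n + 1) - i + 1) * gfun lam nu (n + 1) i =
      Afun lam nu (n + 1) * (Ring.choose (x + Sfun lam nu (n + 1) + 2 * n) (nu (n + 1) + 1) -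
        gfun lam nu (n + 1) (lam (n + 1) + 1)) := by
  by_cases hA : Afun lam nu (n + 1) = 0
  · simp [hA]
  congr 1
  have hlt : nu (n + 1) < lam (n + 1) := by
    rw [Finset.sum_Icc_succ_top (by omega), Finset.sum_Icc_succ_top (by omega)] at h
    have : ∑ m ∈ Finset.Icc 1 n, lam m ≤ ∑ m ∈ Finset.Icc 1 n, nu m := by
      apply Finset.sum_le_sum
      intro m hm
      rw [Finset.mem_Icc] at hm
      exact le_of_Afun_ne_zero hA hm.1 hm.2
    omega
  obtain ⟨a, ha⟩ := exists_Sfun_eq_natCast lam nu n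
  have key := sum_Icc_zbinom_mul_zbinom x (a + 2 * n) _ _ hlt
  have hg : ∀ z : ℤ, gfun lam nu (n + 1) z =
      zbinom (((a + 2 * n : ℕ) : ℤ) + nu (n + 1)) (((a + 2 * n : ℕ) : ℤ) + lam (n + 1) - z) := by
    intro z
    rw [gfun, Nat.add_sub_cancel, ha]
    congr 1 <;> (push_cast; ring)
  simp only [← hg] at key
  rw [Finset.sum_Icc_succ_top (by omega)] at key
  rw [eq_sub_iff_add_eq, Sfun_succ, ha]
  convert key using 1
  · push_cast
    rw [show (lam (n + 1) : ℤ) - (lam (n + 1) + 1) + 1 = ((0 : ℕ) : ℤ) by push_cast; ring]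
    simp [zbinom]
  · congr 1
    push_cast
    ring

theorem sum_Icc_toFun (n : ℕ) (f : Fin n → ℕ) : ∑ m ∈ Finset.Icc 1 n, toFun n f m = ∑ i, f i := by
  rw [← Finset.Ico_add_one_right_eq_Icc, Finset.sum_Ico_eq_sum_range, Nat.add_sub_cancel,
    Finset.sum_range]
  apply Finset.sum_congr rfl
  intro i _
  rw [toFun, dif_pos ⟨by omega, by omega⟩]
  congr 1
  ext
  simp

theorem toFun_eq_zero {n m : ℕ} (f : Fin n → ℕ) (h : ¬ (1 ≤ m ∧ m ≤ n)) : toFun n f m = 0 :=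
  dif_neg h

theorem sum_antidiagonalTuple_ite {n N : ℕ} {G : ℕ → ℕ} (hG : ∀ m, ¬ (1 ≤ m ∧ m ≤ n) → G m = 0)
    (hs : ∑ m ∈ Finset.Icc 1 n, G m = N) (F : (ℕ → ℕ) → ℤ) :
    ∑ mu ∈ Finset.Nat.antidiagonalTuple n N,
      (if ∀ m ∈ Finset.Icc (1 : ℕ) n, toFun n mu m = G m then F (toFun n mu) else 0) = F G := by
  have hmu : toFun n (fun k => G (k + 1)) = G := by
    funext m
    by_cases hm : 1 ≤ m ∧ m ≤ n
    · rw [toFun, dif_pos hm]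
      dsimp only
      rw [Nat.sub_add_cancel hm.1]
    · rw [toFun_eq_zero _ hm, hG m hm]
  rw [Finset.sum_eq_single (fun k : Fin n => G (k + 1))]
  · simp [hmu]
  · intro mu _ hne
    rw [if_neg]
    intro h
    apply hne
    funext k
    have := h (k + 1) (by rw [Finset.mem_Icc]; omega)
    rw [toFun, dif_pos ⟨by omega, by omega⟩] at this
    exact this
  · intro h
    rw [Finset.Nat.mem_antidiagonalTuple, ← sum_Icc_toFun, hmu] at h
    exact absurd hs h

theorem sum_Icc_split {lam : ℕ → ℕ} {t j i : ℕ} (hj : j < t) (hi : 1 ≤ i)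
    (hij : i ≤ lam (j + 1)) :
    ∑ m ∈ Finset.Icc 1 (t + 1), split lam (j + 1) i m + 1 = ∑ m ∈ Finset.Icc 1 t, lam m := by
  obtain ⟨k, rfl⟩ := Nat.exists_eq_add_of_le hj
  have := Sfun_split (nu := fun _ => 0) hi hij k
  rw [show j + 2 + k = j.succ + k + 1 by omega] at this
  simp only [Sfun, Nat.cast_zero, zero_add, add_zero] at this
  zify
  rw [this]
  simp

theorem sum_Icc_merge {nu : ℕ → ℕ} {t j : ℕ} (hj : j < t) :
    ∑ m ∈ Finset.Icc 1 t, merge nu (j + 1) m = ∑ m ∈ Finset.Icc 1 (t + 1), nu m + 1 := by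
  obtain ⟨k, rfl⟩ := Nat.exists_eq_add_of_le hj
  have := Sfun_merge (fun _ => 0) nu j k
  rw [show j + 2 + k = j + 1 + k + 1 by omega] at this
  simp only [Sfun, Nat.cast_zero, add_zero] at this
  rw [Finset.sum_Icc_succ_top (by omega)]
  zify
  exact this

theorem sum_Icc_one (t : ℕ) (f : ℕ → ℤ) :
    ∑ j ∈ Finset.Icc 1 t, f j = ∑ j ∈ range t, f (j + 1) := by
  rw [← Finset.Ico_add_one_right_eq_Icc, Finset.sum_Ico_eq_sum_range, Nat.add_sub_cancel]
  simp only [add_comm 1]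

theorem sum_mul_Dmat (x : ℤ) {t N : ℕ} {lam : ℕ → ℕ} (h0 : ∀ m, ¬ (1 ≤ m ∧ m ≤ t) → lam m = 0)
    (hN : ∑ m ∈ Finset.Icc 1 t, lam m = N + 1) (F : (ℕ → ℕ) → ℤ) :
    ∑ mu ∈ Finset.Nat.antidiagonalTuple (t + 1) N,
        F (toFun (t + 1) mu) * Dmat x t (toFun (t + 1) mu) lam =
      ∑ j ∈ range t, ∑ i ∈ Finset.Icc 1 (lam (j + 1)), F (split lam (j + 1) i) *
        ((-1 : ℤ) ^ (t - (j + 1)) *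
          (if j + 1 = t then zbinom (x + (lam t : ℤ)) ((lam t : ℤ) - i + 1)
          else zbinom ((lam (j + 1) : ℤ) + 1) ((lam (j + 1) : ℤ) - i + 1))) := by
  simp only [Dmat, sum_Icc_one t, Finset.mul_sum]
  rw [Finset.sum_comm]
  apply Finset.sum_congr rfl
  intro j hj
  rw [mem_range] at hj
  rw [Finset.sum_comm]
  apply Finset.sum_congr rfl
  intro i hi
  rw [Finset.mem_Icc] at hi
  have hs := sum_Icc_split hj hi.1 hi.2
  have hz : ∀ m, ¬ (1 ≤ m ∧ m ≤ t + 1) → split lam (j + 1) i m = 0 := by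
    intro m hm
    rcases Nat.eq_zero_or_pos m with rfl | hpos
    · simp [split, h0]
    · simp only [split]
      rw [if_neg (by omega), if_neg (by omega), if_neg (by omega), h0 _ (by omega)]
  have := sum_antidiagonalTuple_ite hz (N := N) (by omega) (fun mu => F mu *
    ((-1 : ℤ) ^ (t - (j + 1)) *
          (if j + 1 = t then zbinom (x + (lam t : ℤ)) ((lam t : ℤ) - i + 1)
          else zbinom ((lam (j + 1) : ℤ) + 1) ((lam (j + 1) : ℤ) - i + 1))))
  refine Eq.trans (Finset.sum_congr rfl fun mu _ => ?_) this
  rw [mul_ite (∀ m ∈ Finset.Icc (1 : ℕ) (t + 1), _), mul_zero]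

theorem eq_split_iff {nu mu : ℕ → ℕ} {t j i : ℕ} (hj : j < t) (hi : 1 ≤ i) (hij : i ≤ mu (j + 1)) :
    (∀ m ∈ Finset.Icc (1 : ℕ) (t + 1), nu m = split mu (j + 1) i m) ↔
      (i = nu (j + 2) + 1 ∧ ∀ m ∈ Finset.Icc (1 : ℕ) t, mu m = merge nu (j + 1) m) := by
  simp only [Finset.mem_Icc]
  constructor
  · intro h
    have h1 := h (j + 1) (by omega)
    have h2 := h (j + 2) (by omega)
    simp only [split, lt_irrefl, if_true, if_false] at h1
    simp only [split] at h2
    rw [if_neg (by omega), if_neg (by omega), if_pos trivial] at h2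
    refine ⟨by omega, fun m hm => ?_⟩
    simp only [merge]
    split_ifs with h3 h4
    · have := h m (by omega)
      simp only [split, if_pos h3] at this
      exact this.symm
    · subst h4
      rw [show j + 1 + 1 = j + 2 from rfl]
      omega
    · have := h (m + 1) (by omega)
      simp only [split] at this
      rw [if_neg (by omega), if_neg (by omega), if_neg (by omega), Nat.add_sub_cancel] at this
      exact this.symm
  · rintro ⟨rfl, h⟩ m hm
    have h1 := h (j + 1) (by omega)
    simp only [merge, lt_irrefl, if_true, if_false, show j + 1 + 1 = j + 2 from rfl] at h1
    simp only [split]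
    split_ifs with h3 h4 h5
    · have := h m (by omega)
      simp only [merge, if_pos h3] at this
      exact this.symm
    · subst h4
      omega
    · subst h5
      rfl
    · have := h (m - 1) (by omega)
      simp only [merge] at this
      rw [if_neg (by omega), if_neg (by omega), Nat.sub_add_cancel hm.1] at this
      exact this.symm

theorem sum_Dmat_mul (y : ℤ) {t N : ℕ} {nu : ℕ → ℕ} (h0 : ∀ m, ¬ (1 ≤ m ∧ m ≤ t + 1) → nu m = 0)
    (hN : ∑ m ∈ Finset.Icc 1 (t + 1), nu m + 1 = N) (F : (ℕ → ℕ) → ℤ) :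
    ∑ mu ∈ Finset.Nat.antidiagonalTuple t N, Dmat y t nu (toFun t mu) * F (toFun t mu) =
      ∑ j ∈ range t, (-1 : ℤ) ^ (t - (j + 1)) *
        (if j + 1 = t then zbinom (y + (nu (j + 1) + nu (j + 2) + 1)) (nu (j + 1) + 1)
          else ((nu (j + 1) + nu (j + 2) + 2).choose (nu (j + 1) + 1) : ℤ)) *
        F (merge nu (j + 1)) := by
  simp only [Dmat, sum_Icc_one t, Finset.sum_mul]
  rw [Finset.sum_comm]
  apply Finset.sum_congr rfl
  intro j hj
  rw [mem_range] at hj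
  have hz : ∀ m, ¬ (1 ≤ m ∧ m ≤ t) → merge nu (j + 1) m = 0 := by
    intro m hm
    rcases Nat.eq_zero_or_pos m with rfl | hpos
    · simp [merge, h0]
    · simp only [merge]
      rw [if_neg (by omega), if_neg (by omega), h0 _ (by omega)]
  have := sum_antidiagonalTuple_ite hz ((sum_Icc_merge hj).trans hN) (fun mu =>
    (-1 : ℤ) ^ (t - (j + 1)) *
        (if j + 1 = t then zbinom (y + (nu (j + 1) + nu (j + 2) + 1)) (nu (j + 1) + 1)
          else ((nu (j + 1) + nu (j + 2) + 2).choose (nu (j + 1) + 1) : ℤ)) * F mu)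
  rw [← this]
  apply Finset.sum_congr rfl
  intro mu _
  generalize toFun t mu = mu
  by_cases hmu : ∀ m ∈ Finset.Icc (1 : ℕ) t, mu m = merge nu (j + 1) m
  · rw [if_pos hmu]
    have h1 := hmu (j + 1) (by rw [Finset.mem_Icc]; omega)
    simp only [merge, lt_irrefl, if_true, if_false, show j + 1 + 1 = j + 2 from rfl] at h1
    rw [Finset.sum_eq_single (nu (j + 2) + 1)]
    · rw [if_pos ((eq_split_iff hj (by omega) (by omega)).mpr ⟨rfl, hmu⟩)]
      congr 2
      split_ifs with ht
      · rw [← ht, h1]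
        congr 1
        push_cast
        ring
      · rw [h1]
        exact zbinom_eq_choose _ _ (by push_cast; ring) (by push_cast; ring)
    · intro i hi hne
      rw [Finset.mem_Icc] at hi
      rw [if_neg, zero_mul]
      rw [eq_split_iff hj hi.1 hi.2]
      exact fun h => hne h.1
    · intro h
      rw [Finset.mem_Icc] at h
      omega
  · rw [if_neg hmu]
    apply Finset.sum_eq_zero
    intro i hi
    rw [Finset.mem_Icc] at hi
    rw [if_neg, zero_mul]
    rw [eq_split_iff hj hi.1 hi.2]
    exact fun h => hmu h.2

theorem neg_one_pow_mul_zbinom (x : ℤ) {d p q : ℕ} (h : p + q + 1 ≤ d) :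
    zbinom (-x - 2 * d + (p + q + 1)) (p + 1) * (-1) ^ (d - (p + q + 1)) =
      (-1) ^ (d - q) * Ring.choose (x + 2 * d - q - 1) (p + 1) := by
  rw [zbinom, if_pos (by positivity), show ((p : ℤ) + 1).toNat = p + 1 by omega,
    show -x - 2 * (d : ℤ) + (p + q + 1) = -(x + 2 * d - (p + q + 1)) by ring, Ring.choose_neg,
    show d - q = d - (p + q + 1) + (p + 1) by omega, pow_add, Units.smul_def, smul_eq_mul,
    show x + 2 * (d : ℤ) - (p + q + 1) + ((p + 1 : ℕ) : ℤ) - 1 = x + 2 * d - q - 1 by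
      push_cast; ring]
  simp only [Int.negOnePow_def, zpow_natCast, Units.val_pow_eq_pow_val, Units.val_neg, Units.val_one]
  ring

theorem neg_one_pow_succ_sub {j n : ℕ} (h : j < n) :
    (-1 : ℤ) ^ (n + 1 - (j + 1)) = (-1) ^ n * (-1) ^ j := by
  obtain ⟨k, rfl⟩ := Nat.exists_eq_add_of_le h.le
  rw [show j + k + 1 - (j + 1) = k by omega, pow_add, mul_right_comm, ← mul_pow]
  simp

/-- `α_•` is a chain map `C_•(x, 1^d) → C_•(-x-2d, 1^d)`:
`α_{d-t} ∘ ∂^x_{d-t+1} = ∂^{-x-2d}_{d-t+1} ∘ α_{d-t+1}` for all `1 ≤ t ≤ d`. Stated on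
basis elements and coefficients: for every weak composition `λ` of `d-t+1` with `t` parts
and every weak composition `ν` of `d-t` with `t+1` parts, the coefficients of `f_ν` on the
two sides agree, for every integer value of `x`. -/
theorem stmt14 (x : ℤ) (d t : ℕ) (ht : 1 ≤ t) (htd : t ≤ d)
    (lam : Fin t → ℕ) (hlam : ∑ i, lam i = d + 1 - t)
    (nu : Fin (t + 1) → ℕ) (hnu : ∑ i, nu i = d - t) :
    ∑ mu ∈ Finset.Nat.antidiagonalTuple (t + 1) (d - t),
        Amat d (t + 1) (toFun (t + 1) mu) (toFun (t + 1) nu) *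
          Dmat x t (toFun (t + 1) mu) (toFun t lam) =
      ∑ mu ∈ Finset.Nat.antidiagonalTuple t (d + 1 - t),
        Dmat (-x - 2 * d) t (toFun (t + 1) nu) (toFun t mu) *
          Amat d t (toFun t lam) (toFun t mu) := by
  obtain ⟨n, rfl⟩ := Nat.exists_eq_add_of_le' ht
  have hl0 : ∀ m, ¬ (1 ≤ m ∧ m ≤ n + 1) → toFun (n + 1) lam m = 0 := fun m => toFun_eq_zero lam
  have hn0 : ∀ m, ¬ (1 ≤ m ∧ m ≤ n + 1 + 1) → toFun (n + 1 + 1) nu m = 0 :=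
    fun m => toFun_eq_zero nu
  rw [← sum_Icc_toFun] at hlam hnu
  generalize toFun (n + 1) lam = L at *
  generalize toFun (n + 1 + 1) nu = V at *
  rw [sum_mul_Dmat x hl0 (by omega) (fun f => Amat d (n + 1 + 1) f V),
    sum_Dmat_mul (-x - 2 * d) hn0 (by omega) (fun f => Amat d (n + 1) L f),
    Finset.sum_range_succ, Finset.sum_range_succ]
  have hV : V (n + 1) + V (n + 2) ≤ d - (n + 1) := by
    rw [Finset.sum_Icc_succ_top (by omega), Finset.sum_Icc_succ_top (by omega)] at hnu
    rw [show n + 2 = n + 1 + 1 from rfl]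
    omega
  have htel := sum_range_Afun_mul_Bfun L V n n le_rfl
  have hlast := Afun_mul_sum_Icc_zbinom_mul_gfun x L V n (by
    rw [Finset.sum_Icc_succ_top (by omega)] at hnu
    omega)
  have hS : x + Sfun L V (n + 1) + 2 * n = x + 2 * d - V (n + 2) - 1 := by
    rw [Finset.sum_Icc_succ_top (by omega)] at hnu
    rw [Sfun, Finset.sum_add_distrib]
    zify [htd, show n + 1 ≤ d + 1 by omega] at hlam hnu
    linarith
  have hB : Bfun (n + 1) L V n = 1 := by simp [Bfun]
  rw [hS, mul_sub] at hlast
  rw [hB, mul_one] at htel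
  have hleft : ∀ j ∈ range n, ∑ i ∈ Finset.Icc 1 (L (j + 1)),
      Amat d (n + 1 + 1) (split L (j + 1) i) V * ((-1 : ℤ) ^ (n + 1 - (j + 1)) *
        (if j + 1 = n + 1 then zbinom (x + (L (n + 1) : ℤ)) ((L (n + 1) : ℤ) - i + 1)
          else zbinom ((L (j + 1) : ℤ) + 1) ((L (j + 1) : ℤ) - i + 1))) =
      (-1) ^ (d - V (n + 2)) * (-1) ^ n * ((-1) ^ j * (Afun L V (j + 1) *
        Bfun (n + 1) L V (j + 1) * ∑ i ∈ Finset.Icc 1 (L (j + 1)),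
          ((L (j + 1) + 1).choose i : ℤ) * gfun L V (j + 1) i * hfun L V (j + 1) i)) := by
    intro j hj
    rw [mem_range] at hj
    simp only [Finset.mul_sum]
    apply Finset.sum_congr rfl
    intro i hi
    rw [Finset.mem_Icc] at hi
    rw [if_neg (by omega), Amat, Afun_split_lt hj hi.1 hi.2,
      zbinom_eq_choose (L (j + 1) + 1) (L (j + 1) + 1 - i) (by push_cast; ring) (by omega),
      Nat.choose_symm (by omega), neg_one_pow_succ_sub hj]
    ring
  have hright : ∀ j ∈ range n, (-1 : ℤ) ^ (n + 1 - (j + 1)) *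
        (if j + 1 = n + 1 then
            zbinom (-x - 2 * d + (V (j + 1) + V (j + 2) + 1)) (V (j + 1) + 1)
          else ((V (j + 1) + V (j + 2) + 2).choose (V (j + 1) + 1) : ℤ)) *
        Amat d (n + 1) L (merge V (j + 1)) =
      (-1) ^ (d - V (n + 2)) * (-1) ^ n * ((-1) ^ j * (Afun L V (j + 1) *
        Bfun (n + 1) L V (j + 1) * (((V (j + 1) + V (j + 2) + 2).choose (V (j + 1) + 1) : ℤ) *
          zbinom (Sfun L V j + V (j + 1) + V (j + 2) + 2 * j + 1)
            (Sfun L V j + L (j + 1) + 2 * j)))) := by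
    intro j hj
    rw [mem_range] at hj
    have hm : merge V (j + 1) (n + 1) = V (n + 2) := by
      simp only [merge]
      rw [if_neg (by omega), if_neg (by omega)]
    rw [if_neg (by omega), Amat, Afun_merge_lt hj, hm, neg_one_pow_succ_sub hj]
    ring
  have hleft_last : ∑ i ∈ Finset.Icc 1 (L (n + 1)),
      Amat d (n + 1 + 1) (split L (n + 1) i) V * ((-1 : ℤ) ^ (n + 1 - (n + 1)) *
        (if n + 1 = n + 1 then zbinom (x + (L (n + 1) : ℤ)) ((L (n + 1) : ℤ) - i + 1)
          else zbinom ((L (n + 1) : ℤ) + 1) ((L (n + 1) : ℤ) - i + 1))) =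
      (-1) ^ (d - V (n + 2)) * (Afun L V (n + 1) * ∑ i ∈ Finset.Icc 1 (L (n + 1)),
        zbinom (x + L (n + 1)) (L (n + 1) - i + 1) * gfun L V (n + 1) i) := by
    simp only [Finset.mul_sum]
    apply Finset.sum_congr rfl
    intro i hi
    rw [Finset.mem_Icc] at hi
    rw [if_pos trivial, Amat, Afun_split_last hi.2, Nat.sub_self, pow_zero]
    ring
  have hm : merge V (n + 1) (n + 1) = V (n + 1) + V (n + 2) + 1 := by simp [merge]
  have hsign := neg_one_pow_mul_zbinom x (d := d) (p := V (n + 1)) (q := V (n + 2)) (by omega)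
  rw [Finset.sum_congr rfl hleft, Finset.sum_congr rfl hright, hleft_last, if_pos rfl, Nat.sub_self,
    pow_zero, one_mul, Amat, hm, Afun_merge_last, ← mul_assoc (zbinom _ _), hsign, hlast, ← sub_eq_zero]
  simp only [mul_sub, Finset.sum_sub_distrib] at htel
  simp only [← Finset.mul_sum]
  rw [sub_eq_iff_eq_add] at htel
  rw [htel]
  have hsq : ((-1 : ℤ) ^ n) * (-1) ^ n = 1 := by rw [← mul_pow]; simp
  linear_combination (-1) ^ (d - V (n + 2)) * Afun L V (n + 1) *
    gfun L V (n + 1) (L (n + 1) + 1) * hsq
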